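/- The absolute value of the product curvature is an intrinsic invariant: let f, ν and f̃, ν̃ both be frontals with unit normals near p = (0,0) whose first fundamental forms agree, i.e. ⟨f_u, f_u⟩ = ⟨f̃_u, f̃_u⟩, ⟨f_u, f_v⟩ = ⟨f̃_u, f̃_v⟩ and ⟨f_v, f_v⟩ = ⟨f̃_v, f̃_v⟩ identically on a neighborhood of p. Suppose f, ν satisfy the adapted coordinate conditions at the first-kind singular point p, and suppose ν̃(u,0) = f̃_u(u,0) × f̃_vv(u,0) for all u near 0. Then |⟨f_uu(0,0), ν(0,0)⟩ · det(f_u, f_vv, f_vvv)(0,0)| = |⟨f̃_uu(0,0), ν̃(0,0)⟩ · det(f̃_u, f̃_vv, f̃_vvv)(0,0)|, i.e. |κ_Π(p)| = |κ̃_Π(p)|. -/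

import Mathlib

open scoped RealInnerProductSpace
open Filter

noncomputable section

/-- Euclidean 3-space. -/
abbrev E3 : Type := EuclideanSpace ℝ (Fin 3)

/-- Partial derivative in the first (`u`) direction. -/
def pu {E : Type*} [NormedAddCommGroup E] [NormedSpace ℝ E] (f : ℝ × ℝ → E) (q : ℝ × ℝ) : E :=
  fderiv ℝ f q (1, 0)

/-- Partial derivative in the second (`v`) direction. -/
def pv {E : Type*} [NormedAddCommGroup E] [NormedSpace ℝ E] (f : ℝ × ℝ → E) (q : ℝ × ℝ) : E :=
  fderiv ℝ f q (0, 1)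

/-- Determinant of three column vectors in `ℝ³`. -/
def det3 (a b c : E3) : ℝ :=
  Matrix.det !![a 0, b 0, c 0; a 1, b 1, c 1; a 2, b 2, c 2]

/-- Cross product in `ℝ³`. -/
def cross3 (a b : E3) : E3 :=
  (WithLp.equiv 2 (Fin 3 → ℝ)).symm
    ![a 1 * b 2 - a 2 * b 1, a 2 * b 0 - a 0 * b 2, a 0 * b 1 - a 1 * b 0]

/-- Coefficients of the first fundamental form. -/
def Ec (f : ℝ × ℝ → E3) (q : ℝ × ℝ) : ℝ := ⟪pu f q, pu f q⟫
def Fc (f : ℝ × ℝ → E3) (q : ℝ × ℝ) : ℝ := ⟪pu f q, pv f q⟫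
def Gc (f : ℝ × ℝ → E3) (q : ℝ × ℝ) : ℝ := ⟪pv f q, pv f q⟫

/-- Coefficients of the second fundamental form. -/
def Lc (f ν : ℝ × ℝ → E3) (q : ℝ × ℝ) : ℝ := ⟪pu (pu f) q, ν q⟫
def Mc (f ν : ℝ × ℝ → E3) (q : ℝ × ℝ) : ℝ := ⟪pv (pu f) q, ν q⟫
def Nc (f ν : ℝ × ℝ → E3) (q : ℝ × ℝ) : ℝ := ⟪pv (pv f) q, ν q⟫

/-- The mean curvature `H = (E N − 2 F M + G L)/(2(E G − F²))`. -/
def meanCurv (f ν : ℝ × ℝ → E3) (q : ℝ × ℝ) : ℝ :=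
  (Ec f q * Nc f ν q - 2 * Fc f q * Mc f ν q + Gc f q * Lc f ν q) /
    (2 * (Ec f q * Gc f q - Fc f q ^ 2))

/-- The Gaussian curvature `K = (L N − M²)/(E G − F²)`. -/
def gaussCurv (f ν : ℝ × ℝ → E3) (q : ℝ × ℝ) : ℝ :=
  (Lc f ν q * Nc f ν q - Mc f ν q ^ 2) / (Ec f q * Gc f q - Fc f q ^ 2)

section PartialDerivatives

variable {V : Type*} [NormedAddCommGroup V] [NormedSpace ℝ V]

lemma contDiff_pu {g : ℝ × ℝ → V} (hg : ContDiff ℝ (⊤ : ℕ∞) g) :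
    ContDiff ℝ (⊤ : ℕ∞) (pu g) :=
  (hg.fderiv_right (m := (⊤ : ℕ∞)) (by simp)).clm_apply contDiff_const

lemma contDiff_pv {g : ℝ × ℝ → V} (hg : ContDiff ℝ (⊤ : ℕ∞) g) :
    ContDiff ℝ (⊤ : ℕ∞) (pv g) :=
  (hg.fderiv_right (m := (⊤ : ℕ∞)) (by simp)).clm_apply contDiff_const

lemma ContDiff.differentiable_of_top {g : ℝ × ℝ → V} (hg : ContDiff ℝ (⊤ : ℕ∞) g) :
    Differentiable ℝ g :=
  hg.differentiable (by simp)

lemma pu_pv_comm {g : ℝ × ℝ → V} (hg : ContDiff ℝ (⊤ : ℕ∞) g) : pu (pv g) = pv (pu g) := by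
  have hd : Differentiable ℝ (fderiv ℝ g) :=
    (hg.fderiv_right (m := (⊤ : ℕ∞)) (by simp)).differentiable (by simp)
  have hsymm (q : ℝ × ℝ) : IsSymmSndFDerivAt ℝ g q :=
    hg.contDiffAt.isSymmSndFDerivAt (by
      simp only [minSmoothness_of_isRCLikeNormedField]
      exact WithTop.coe_le_coe.2 (le_top (a := (2 : ℕ∞))))
  ext1 q
  unfold pu pv
  rw [fderiv_clm_apply (hd q) (differentiableAt_const _),
    fderiv_clm_apply (hd q) (differentiableAt_const _)]
  simpa using (hsymm q).eq (1, 0) (0, 1)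

lemma pu_add {g h : ℝ × ℝ → V} (hg : ContDiff ℝ (⊤ : ℕ∞) g) (hh : ContDiff ℝ (⊤ : ℕ∞) h) :
    pu (fun q => g q + h q) = fun q => pu g q + pu h q := by
  ext1 q
  simp [pu, fderiv_fun_add (hg.differentiable_of_top q) (hh.differentiable_of_top q)]

lemma pv_add {g h : ℝ × ℝ → V} (hg : ContDiff ℝ (⊤ : ℕ∞) g) (hh : ContDiff ℝ (⊤ : ℕ∞) h) :
    pv (fun q => g q + h q) = fun q => pv g q + pv h q := by
  ext1 q
  simp [pv, fderiv_fun_add (hg.differentiable_of_top q) (hh.differentiable_of_top q)]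

lemma Filter.EventuallyEq.pu {g h : ℝ × ℝ → V} {q : ℝ × ℝ} (e : g =ᶠ[nhds q] h) :
    pu g =ᶠ[nhds q] pu h :=
  (e.fderiv (𝕜 := ℝ)).mono fun x hx => by simp only [_root_.pu, hx]

lemma Filter.EventuallyEq.pv {g h : ℝ × ℝ → V} {q : ℝ × ℝ} (e : g =ᶠ[nhds q] h) :
    pv g =ᶠ[nhds q] pv h :=
  (e.fderiv (𝕜 := ℝ)).mono fun x hx => by simp only [_root_.pv, hx]

lemma pu_eq_zero_of_axis {g : ℝ × ℝ → V} (hg : ContDiff ℝ (⊤ : ℕ∞) g)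
    (h0 : ∀ᶠ u in nhds (0 : ℝ), g (u, 0) = 0) : ∀ᶠ u in nhds (0 : ℝ), pu g (u, 0) = 0 := by
  filter_upwards [h0.eventually_nhds] with u hu
  have h1 : HasDerivAt (fun t : ℝ => g (t, 0)) (pu g (u, 0)) u :=
    (hg.differentiable_of_top (u, 0)).hasFDerivAt.comp_hasDerivAt u
      ((hasDerivAt_id u).prodMk (hasDerivAt_const u (0 : ℝ)))
  have h2 : HasDerivAt (fun t : ℝ => g (t, 0)) 0 u :=
    (hasDerivAt_const u (0 : V)).congr_of_eventuallyEq hu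
  exact h1.unique h2

variable {H : Type*} [NormedAddCommGroup H] [InnerProductSpace ℝ H]

lemma pu_inner {a b : ℝ × ℝ → H} (ha : ContDiff ℝ (⊤ : ℕ∞) a) (hb : ContDiff ℝ (⊤ : ℕ∞) b) :
    pu (fun q => ⟪a q, b q⟫) = fun q => ⟪a q, pu b q⟫ + ⟪pu a q, b q⟫ := by
  ext1 q
  exact fderiv_inner_apply ℝ (ha.differentiable_of_top q) (hb.differentiable_of_top q) _

lemma pv_inner {a b : ℝ × ℝ → H} (ha : ContDiff ℝ (⊤ : ℕ∞) a) (hb : ContDiff ℝ (⊤ : ℕ∞) b) :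
    pv (fun q => ⟪a q, b q⟫) = fun q => ⟪a q, pv b q⟫ + ⟪pv a q, b q⟫ := by
  ext1 q
  exact fderiv_inner_apply ℝ (ha.differentiable_of_top q) (hb.differentiable_of_top q) _

end PartialDerivatives

/-- The product of two triple products sharing two factors is a Gram determinant. -/
lemma inner_cross3_mul_det3 (e₁ e₂ a b : E3) :
    ⟪a, cross3 e₁ e₂⟫ * det3 e₁ e₂ b =
      ⟪e₁, e₁⟫ * (⟪e₂, e₂⟫ * ⟪a, b⟫ - ⟪e₂, b⟫ * ⟪a, e₂⟫) -
      ⟪e₁, e₂⟫ * (⟪e₁, e₂⟫ * ⟪a, b⟫ - ⟪e₂, b⟫ * ⟪a, e₁⟫) +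
      ⟪e₁, b⟫ * (⟪e₁, e₂⟫ * ⟪a, e₂⟫ - ⟪e₂, e₂⟫ * ⟪a, e₁⟫) := by
  simp [-inner_self_eq_norm_sq_to_K, cross3, det3, Matrix.det_fin_three, PiLp.inner_apply,
    Fin.sum_univ_three]
  ring

/-- On the singular axis, the inner products of the derivatives of `f` entering the product
curvature are combinations of derivatives of the first fundamental form. -/
lemma inner_derivatives_eq {f : ℝ × ℝ → E3} (hf : ContDiff ℝ (⊤ : ℕ∞) f)
    (h0 : ∀ᶠ u in nhds (0 : ℝ), pv f (u, 0) = 0) :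
    ⟪pu f (0, 0), pu f (0, 0)⟫ = Ec f (0, 0) ∧
    ⟪pu f (0, 0), pv (pv f) (0, 0)⟫ = pv (Fc f) (0, 0) ∧
    ⟪pv (pv f) (0, 0), pv (pv f) (0, 0)⟫ = pv (pv (Gc f)) (0, 0) / 2 ∧
    ⟪pu (pu f) (0, 0), pu f (0, 0)⟫ = pu (Ec f) (0, 0) / 2 ∧
    ⟪pu (pu f) (0, 0), pv (pv f) (0, 0)⟫ =
      pu (pv (Fc f)) (0, 0) - pv (pv (Ec f)) (0, 0) / 2 - pu (pu (Gc f)) (0, 0) / 2 ∧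
    ⟪pu f (0, 0), pv (pv (pv f)) (0, 0)⟫ = pv (pv (Fc f)) (0, 0) ∧
    ⟪pv (pv f) (0, 0), pv (pv (pv f)) (0, 0)⟫ = pv (pv (pv (Gc f))) (0, 0) / 6 ∧
    ⟪pu (pu f) (0, 0), pv (pv (pv f)) (0, 0)⟫ =
      pv (pu (pv (Fc f))) (0, 0) - pv (pv (pv (Ec f))) (0, 0) / 2 -
        pv (pu (pu (Gc f))) (0, 0) / 2 := by
  have hu := contDiff_pu hf
  have hv := contDiff_pv hf
  have hvu := contDiff_pv hu
  have huu := contDiff_pu hu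
  have hvv := contDiff_pv hv
  have hvvu := contDiff_pv hvu
  have hvuu := contDiff_pv huu
  have hvvv := contDiff_pv hvv
  have c1 := pu_pv_comm hf
  have c2 := pu_pv_comm hu
  have c3 := pu_pv_comm hv
  rw [c1] at c3
  have h1 := pu_eq_zero_of_axis hv h0
  have h2 := (pu_eq_zero_of_axis (contDiff_pu hv) h1).self_of_nhds
  replace h1 := h1.self_of_nhds
  replace h0 := h0.self_of_nhds
  rw [c1] at h1 h2
  rw [c2] at h2
  have hE : Ec f = fun q => ⟪pu f q, pu f q⟫ := rfl
  have hF : Fc f = fun q => ⟪pu f q, pv f q⟫ := rfl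
  have hG : Gc f = fun q => ⟪pv f q, pv f q⟫ := rfl
  simp (maxDischargeDepth := 6) only [hE, hF, hG, pu_inner, pv_inner, pu_add, pv_add,
    ContDiff.inner, ContDiff.add, hu, hv, hvu, huu, hvv, hvvu, hvuu, hvvv, c1, c2, c3, h0,
    h1, h2, inner_zero_left, inner_zero_right]
  refine ⟨trivial, ?_, ?_, ?_, ?_, ?_, ?_, ?_⟩ <;>
    simp only [real_inner_comm, add_zero, zero_add] <;> ring

/-- **The absolute value of the product curvature is intrinsic.** If two frontals `f` and
`f̃` with unit normals `ν`, `ν̃` have the same first fundamental form near the origin, `f`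
satisfies the adapted coordinate conditions at the first-kind singular point `(0,0)`, and
`ν̃ = f̃_u × f̃_vv` along the `u`-axis, then `|κ_Π| = |κ̃_Π|` at the origin. -/
theorem abs_product_curvature_intrinsic
    (f ν ft νt : ℝ × ℝ → E3)
    (hf : ContDiff ℝ (⊤ : ℕ∞) f) (hν : ContDiff ℝ (⊤ : ℕ∞) ν)
    (hft : ContDiff ℝ (⊤ : ℕ∞) ft) (hνt : ContDiff ℝ (⊤ : ℕ∞) νt)
    (hfrontal : ∀ q : ℝ × ℝ, ‖ν q‖ = 1 ∧ ⟪ν q, pu f q⟫ = 0 ∧ ⟪ν q, pv f q⟫ = 0)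
    (hfrontalt : ∀ q : ℝ × ℝ, ‖νt q‖ = 1 ∧ ⟪νt q, pu ft q⟫ = 0 ∧ ⟪νt q, pv ft q⟫ = 0)
    (hiso : ∀ᶠ q in nhds ((0, 0) : ℝ × ℝ),
      ⟪pu f q, pu f q⟫ = ⟪pu ft q, pu ft q⟫ ∧
      ⟪pu f q, pv f q⟫ = ⟪pu ft q, pv ft q⟫ ∧
      ⟪pv f q, pv f q⟫ = ⟪pv ft q, pv ft q⟫)
    (hadapted : ∀ᶠ u in nhds (0 : ℝ),
      pv f (u, 0) = 0 ∧ ‖pu f (u, 0)‖ = 1 ∧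
      ⟪pu f (u, 0), pv (pv f) (u, 0)⟫ = 0 ∧ ‖pv (pv f) (u, 0)‖ = 1 ∧
      ν (u, 0) = cross3 (pu f (u, 0)) (pv (pv f) (u, 0)))
    (hreg : ∀ᶠ q in nhds ((0, 0) : ℝ × ℝ), q.2 ≠ 0 → Ec f q * Gc f q - Fc f q ^ 2 ≠ 0)
    (hνt0 : ∀ᶠ u in nhds (0 : ℝ),
      νt (u, 0) = cross3 (pu ft (u, 0)) (pv (pv ft) (u, 0))) :
    |⟪pu (pu f) (0, 0), ν (0, 0)⟫ *
        det3 (pu f (0, 0)) (pv (pv f) (0, 0)) (pv (pv (pv f)) (0, 0))| =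
      |⟪pu (pu ft) (0, 0), νt (0, 0)⟫ *
        det3 (pu ft (0, 0)) (pv (pv ft) (0, 0)) (pv (pv (pv ft)) (0, 0))| := by
  have hE : Ec f =ᶠ[nhds (0, 0)] Ec ft := hiso.mono fun q h => h.1
  have hF : Fc f =ᶠ[nhds (0, 0)] Fc ft := hiso.mono fun q h => h.2.1
  have hG : Gc f =ᶠ[nhds (0, 0)] Gc ft := hiso.mono fun q h => h.2.2
  have h0 : ∀ᶠ u in nhds (0 : ℝ), pv f (u, 0) = 0 := hadapted.mono fun u h => h.1
  have haxis : Tendsto (fun u : ℝ => (u, (0 : ℝ))) (nhds 0) (nhds (0, 0)) :=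
    (Continuous.prodMk_left (0 : ℝ)).tendsto 0
  have h0t : ∀ᶠ u in nhds (0 : ℝ), pv ft (u, 0) = 0 := by
    filter_upwards [h0, haxis.eventually hG] with u hu hGu
    simpa [Gc, hu] using hGu.symm
  rw [hadapted.self_of_nhds.2.2.2.2, hνt0.self_of_nhds, inner_cross3_mul_det3,
    inner_cross3_mul_det3]
  obtain ⟨a1, a2, a3, a4, a5, a6, a7, a8⟩ := inner_derivatives_eq hf h0
  obtain ⟨b1, b2, b3, b4, b5, b6, b7, b8⟩ := inner_derivatives_eq hft h0t
  rw [a1, a2, a3, a4, a5, a6, a7, a8, b1, b2, b3, b4, b5, b6, b7, b8, hE.eq_of_nhds,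
    hE.pu.eq_of_nhds, hE.pv.pv.eq_of_nhds, hE.pv.pv.pv.eq_of_nhds, hF.pv.eq_of_nhds,
    hF.pv.pv.eq_of_nhds, hF.pv.pu.eq_of_nhds, hF.pv.pu.pv.eq_of_nhds, hG.pv.pv.eq_of_nhds,
    hG.pv.pv.pv.eq_of_nhds, hG.pu.pu.eq_of_nhds, hG.pu.pu.pv.eq_of_nhds]
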